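/- arXiv:2305.05405 — 2 statements merged into one kernel-verified Lean document; each statement's English description precedes it below -/
import Mathlib

section
/- Let G be a graph, W a set of vertices, and let SK be the union of all edges lying on some simple path between two vertices of W. Then every simple path between two vertices incident to edges of SK uses only edges of SK. -/
def IsCactus {V : Type*} (G : SimpleGraph V) : Prop :=
  G.Connected ∧
    ∀ {u v : V} (c : G.Walk u u) (d : G.Walk v v), c.IsCycle → d.IsCycle →
      ∀ e, e ∈ c.edges → e ∈ d.edges → ∀ f, (f ∈ c.edges ↔ f ∈ d.edges)

/-- The skeleton determined by a set `W` of border vertices: all edges lying on some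
simple path between two distinct vertices of `W`. -/
def Skeleton {V : Type*} (G : SimpleGraph V) (W : Set V) : Set (Sym2 V) :=
  {e | ∃ u v, u ∈ W ∧ v ∈ W ∧ u ≠ v ∧ ∃ p : G.Walk u v, p.IsPath ∧ e ∈ p.edges}

/-- A skeleton vertex: a vertex incident to a skeleton edge. -/
def SkeletonVertex {V : Type*} (G : SimpleGraph V) (W : Set V) (x : V) : Prop :=
  ∃ e ∈ Skeleton G W, x ∈ e

open SimpleGraph in
theorem sk_of_support {V : Type*} {G : SimpleGraph V} {W : Set V} {u v : V} (hu : u ∈ W)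
    (hv : v ∈ W) (huv : u ≠ v) (p : G.Walk u v) (hp : p.IsPath) {x : V} (hx : x ∈ p.support) :
    SkeletonVertex G W x := by
  have hn : ¬ p.Nil := fun h => huv h.eq
  obtain ⟨e, he, hxe⟩ := (Walk.mem_support_iff_exists_mem_edges_of_not_nil hn).1 hx
  exact ⟨e, ⟨u, v, hu, hv, huv, p, hp, he⟩, hxe⟩

open SimpleGraph in
theorem path_split {V : Type*} {G : SimpleGraph V} {u v a : V} (T : G.Walk u a) (D : G.Walk a v)
    (h : (T.append D).IsPath) {x : V} (hT : x ∈ T.support) (hD : x ∈ D.support) : x = a := by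
  classical
  by_contra hne
  have h2 := h.support_nodup
  rw [Walk.support_append] at h2
  have h3 := (List.nodup_append.1 h2).2.2
  have : x ∈ D.support.tail := by
    rw [Walk.mem_support_iff] at hD
    tauto
  exact h3 x hT x this rfl

open SimpleGraph in
theorem split_case {V : Type*} [DecidableEq V] {G : SimpleGraph V} {u v a b : V} (P : G.Walk u v)
    (hP : P.IsPath) (ha : a ∈ P.support) (hb : b ∈ (P.takeUntil a ha).support) (hab : a ≠ b) :
    ∃ (A : G.Walk a v) (B : G.Walk b u), A.IsPath ∧ B.IsPath ∧
      (∀ x ∈ A.support, x ∉ B.support) ∧ (∀ x ∈ A.support, x ∈ P.support) ∧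
      (∀ x ∈ B.support, x ∈ P.support) := by
  have hT := hP.takeUntil ha
  refine ⟨P.dropUntil a ha, ((P.takeUntil a ha).takeUntil b hb).reverse, hP.dropUntil ha,
    (hT.takeUntil hb).reverse, ?_, ?_, ?_⟩
  · intro x hx hx2
    rw [Walk.support_reverse, List.mem_reverse] at hx2
    have hx3 := Walk.support_takeUntil_subset_support _ hb hx2
    have : x = a := path_split (P.takeUntil a ha) (P.dropUntil a ha)
      (by rw [Walk.take_spec]; exact hP) hx3 hx
    subst this
    exact Walk.endpoint_notMem_support_takeUntil hT hb hab hx2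
  · intro x hx
    exact Walk.support_dropUntil_subset_support _ ha hx
  · intro x hx2
    rw [Walk.support_reverse, List.mem_reverse] at hx2
    exact Walk.support_takeUntil_subset_support _ ha (Walk.support_takeUntil_subset_support _ hb hx2)

open SimpleGraph in
theorem dir_case {V : Type*} {G : SimpleGraph V} {W : Set V} {u v a : V} (P : G.Walk u v)
    (hP : P.IsPath) (hu : u ∈ W) (hv : v ∈ W) (ha : a ∈ P.support) {b w : V} (R : G.Walk b w)
    (hw : w ∈ W) (hR : R.IsPath) (haR : a ∉ R.support) :
    ∃ w₁ w₂, w₁ ∈ W ∧ w₂ ∈ W ∧ ∃ (A : G.Walk a w₁) (B : G.Walk b w₂), A.IsPath ∧ B.IsPath ∧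
      (∀ x ∈ A.support, x ∉ B.support) ∧ (∀ x ∈ A.support, x ∈ P.support) ∧
      (∀ x ∈ B.support, x ∈ P.support ∨ x ∈ R.support) := by
  classical
  have key : ∀ b, b ≠ a → b ∈ P.support → ∃ w₁ w₂, w₁ ∈ W ∧ w₂ ∈ W ∧
      ∃ (A : G.Walk a w₁) (B : G.Walk b w₂), A.IsPath ∧ B.IsPath ∧
      (∀ x ∈ A.support, x ∉ B.support) ∧ (∀ x ∈ A.support, x ∈ P.support) ∧
      (∀ x ∈ B.support, x ∈ P.support) := by
    intro b hba hb
    by_cases h : b ∈ (P.takeUntil a ha).support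
    · obtain ⟨A, B, h⟩ := split_case P hP ha h hba.symm
      exact ⟨v, u, hv, hu, A, B, h⟩
    · have hb' : b ∈ (P.dropUntil a ha).support := by
        have h3 := hb
        rw [← Walk.take_spec P ha, Walk.mem_support_append_iff] at h3
        tauto
      -- `b` lies strictly after `a` on `P`
      refine ⟨u, v, hu, hv, (P.takeUntil a ha).reverse, (P.dropUntil a ha).dropUntil b hb',
        (hP.takeUntil ha).reverse, (hP.dropUntil ha).dropUntil hb', ?_, ?_, ?_⟩
      · intro x hx hx2
        rw [Walk.support_reverse, List.mem_reverse] at hx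
        have hx3 := Walk.support_dropUntil_subset_support _ hb' hx2
        have hxa : x = a := path_split (P.takeUntil a ha) (P.dropUntil a ha)
          (by rw [Walk.take_spec]; exact hP) hx hx3
        subst hxa
        have := path_split ((P.dropUntil x ha).takeUntil b hb') ((P.dropUntil x ha).dropUntil b hb')
          (by rw [Walk.take_spec]; exact hP.dropUntil ha) (Walk.start_mem_support _) hx2
        exact hba this.symm
      · intro x hx
        rw [Walk.support_reverse, List.mem_reverse] at hx
        exact Walk.support_takeUntil_subset_support _ ha hx
      · intro x hx
        exact Walk.support_dropUntil_subset_support _ ha (Walk.support_dropUntil_subset_support _ hb' hx)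
  induction R with
  | nil =>
    rename_i b
    by_cases hb : b ∈ P.support
    · obtain ⟨w₁, w₂, h1, h2, A, B, h3, h4, h5, h6, h7⟩ := key b (by rintro rfl; simp at haR) hb
      exact ⟨w₁, w₂, h1, h2, A, B, h3, h4, h5, h6, fun x hx => Or.inl (h7 x hx)⟩
    · refine ⟨v, b, hv, hw, P.dropUntil a ha, Walk.nil, hP.dropUntil ha, by simp, ?_, ?_, ?_⟩
      · intro x hx hx2
        simp at hx2
        subst hx2
        exact hb (Walk.support_dropUntil_subset_support _ ha hx)
      · intro x hx
        exact Walk.support_dropUntil_subset_support _ ha hx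
      · intro x hx
        exact Or.inr hx
  | @cons b c w hbc R ih =>
    by_cases hb : b ∈ P.support
    · obtain ⟨w₁, w₂, h1, h2, A, B, h3, h4, h5, h6, h7⟩ := key b (by rintro rfl; simp at haR) hb
      exact ⟨w₁, w₂, h1, h2, A, B, h3, h4, h5, h6, fun x hx => Or.inl (h7 x hx)⟩
    · rw [Walk.cons_isPath_iff] at hR
      rw [Walk.support_cons, List.mem_cons, not_or] at haR
      obtain ⟨w₁, w₂, h1, h2, A, B, h3, h4, h5, h6, h7⟩ := ih hw hR.1 haR.2
      refine ⟨w₁, w₂, h1, h2, A, Walk.cons hbc B, h3, ?_, ?_, h6, ?_⟩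
      · rw [Walk.cons_isPath_iff]
        refine ⟨h4, fun h => ?_⟩
        rcases h7 b h with h | h
        · exact hb h
        · exact hR.2 h
      · intro x hx hx2
        rw [Walk.support_cons, List.mem_cons] at hx2
        rcases hx2 with rfl | hx2
        · exact hb (h6 _ hx)
        · exact h5 x hx hx2
      · intro x hx2
        rw [Walk.support_cons, List.mem_cons] at hx2 ⊢
        rcases hx2 with rfl | hx2
        · simp
        · have := h7 x hx2
          tauto

open SimpleGraph in
theorem sk_path {V : Type*} {G : SimpleGraph V} {W : Set V} {x : V} (h : SkeletonVertex G W x) :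
    ∃ u v, u ∈ W ∧ v ∈ W ∧ u ≠ v ∧ ∃ p : G.Walk u v, p.IsPath ∧ x ∈ p.support := by
  obtain ⟨e, ⟨u, v, hu, hv, huv, p, hp, he⟩, hx⟩ := h
  exact ⟨u, v, hu, hv, huv, p, hp, Walk.mem_support_of_mem_edges he hx⟩

open SimpleGraph in
theorem two_paths {V : Type*} {G : SimpleGraph V} {W : Set V} {a b : V} (hab : a ≠ b)
    (ha : SkeletonVertex G W a) (hb : SkeletonVertex G W b) :
    ∃ w₁ w₂, w₁ ∈ W ∧ w₂ ∈ W ∧ ∃ (A : G.Walk a w₁) (B : G.Walk b w₂), A.IsPath ∧ B.IsPath ∧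
      (∀ x ∈ A.support, x ∉ B.support) ∧ (∀ x ∈ A.support, SkeletonVertex G W x) ∧
      (∀ x ∈ B.support, SkeletonVertex G W x) := by
  classical
  obtain ⟨u, v, hu, hv, huv, P, hP, haP⟩ := sk_path ha
  obtain ⟨u', v', hu', hv', huv', Q, hQ, hbQ⟩ := sk_path hb
  have fin : ∀ w ∈ W, ∀ R : G.Walk b w, R.IsPath → a ∉ R.support →
      (∀ x ∈ R.support, x ∈ Q.support) → ∃ w₁ w₂, w₁ ∈ W ∧ w₂ ∈ W ∧
      ∃ (A : G.Walk a w₁) (B : G.Walk b w₂), A.IsPath ∧ B.IsPath ∧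
      (∀ x ∈ A.support, x ∉ B.support) ∧ (∀ x ∈ A.support, SkeletonVertex G W x) ∧
      (∀ x ∈ B.support, SkeletonVertex G W x) := by
    intro w hw R hR haR hRQ
    obtain ⟨w₁, w₂, h1, h2, A, B, h3, h4, h5, h6, h7⟩ := dir_case P hP hu hv haP R hw hR haR
    refine ⟨w₁, w₂, h1, h2, A, B, h3, h4, h5, fun x hx => sk_of_support hu hv huv P hP (h6 x hx),
      fun x hx => ?_⟩
    rcases h7 x hx with h | h
    · exact sk_of_support hu hv huv P hP h
    · exact sk_of_support hu' hv' huv' Q hQ (hRQ x h)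
  by_cases h : a ∈ (Q.takeUntil b hbQ).support
  · refine fin v' hv' (Q.dropUntil b hbQ) (hQ.dropUntil hbQ) ?_
      (fun x hx => Walk.support_dropUntil_subset_support _ hbQ hx)
    intro h'
    exact hab (path_split _ _ (by rw [Walk.take_spec]; exact hQ) h h')
  · refine fin u' hu' (Q.takeUntil b hbQ).reverse (hQ.takeUntil hbQ).reverse (by simpa using h) ?_
    intro x hx
    rw [Walk.support_reverse, List.mem_reverse] at hx
    exact Walk.support_takeUntil_subset_support _ hbQ hx

open SimpleGraph in
theorem append_path {V : Type*} {G : SimpleGraph V} {a b c : V} (p : G.Walk a b) (q : G.Walk b c)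
    (hp : p.IsPath) (hq : q.IsPath) (h : ∀ x ∈ p.support, x ∈ q.support → x = b) :
    (p.append q).IsPath := by
  rw [Walk.isPath_def, Walk.support_append]
  have hq' := hq.support_nodup
  rw [← Walk.cons_tail_support, List.nodup_cons] at hq'
  refine List.nodup_append.2 ⟨hp.support_nodup, hq'.2, ?_⟩
  rintro x hx y hy rfl
  have := h x hx (List.mem_of_mem_tail hy)
  subst this
  exact hq'.1 hy

open SimpleGraph in
theorem ear {V : Type*} {G : SimpleGraph V} {W : Set V} {a b : V}
    (ha : SkeletonVertex G W a) (hb : SkeletonVertex G W b) (p : G.Walk a b) (hp : p.IsPath)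
    (hab : a ≠ b) (hint : ∀ x ∈ p.support, SkeletonVertex G W x → x = a ∨ x = b) :
    ∀ e ∈ p.edges, e ∈ Skeleton G W := by
  intro e he
  obtain ⟨w₁, w₂, h1, h2, A, B, h3, h4, h5, h6, h7⟩ := two_paths hab ha hb
  refine ⟨w₁, w₂, h1, h2, ?_, A.reverse.append (p.append B), ?_, by simp [he]⟩
  · rintro rfl
    exact h5 _ A.end_mem_support B.end_mem_support
  · refine append_path _ _ h3.reverse (append_path _ _ hp h4 ?_) ?_
    · intro x hx hx2
      rcases hint x hx (h7 x hx2) with rfl | rfl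
      · exact absurd hx2 (h5 _ A.start_mem_support)
      · rfl
    · intro x hx hx2
      rw [Walk.support_reverse, List.mem_reverse] at hx
      rw [Walk.mem_support_append_iff] at hx2
      rcases hx2 with hx2 | hx2
      · rcases hint x hx2 (h6 x hx) with rfl | rfl
        · rfl
        · exact absurd B.start_mem_support (h5 _ hx)
      · exact absurd hx2 (h5 _ hx)

open SimpleGraph in
theorem sk_main {V : Type*} {G : SimpleGraph V} {W : Set V} (n : ℕ) : ∀ {a b : V}
    (_ : SkeletonVertex G W a) (_ : SkeletonVertex G W b) (p : G.Walk a b) (_ : p.IsPath)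
    (_ : p.length = n), ∀ e ∈ p.edges, e ∈ Skeleton G W := by
  classical
  induction n using Nat.strong_induction_on with
  | _ n ih =>
  intro a b ha hb p hp hn
  by_cases hab : a = b
  · subst hab
    have := Walk.isPath_iff_nil.1 hp
    rw [Walk.nil_iff_eq_nil] at this
    simp [this]
  by_cases h : ∀ x ∈ p.support, SkeletonVertex G W x → x = a ∨ x = b
  · exact ear ha hb p hp hab h
  push Not at h
  obtain ⟨x, hx, hsx, hxa, hxb⟩ := h
  have hlen : (p.takeUntil x hx).length + (p.dropUntil x hx).length = n := by
    rw [← Walk.length_append, Walk.take_spec, hn]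
  have l1 : (p.takeUntil x hx).length ≠ 0 := fun h => hxa (Walk.eq_of_length_eq_zero h).symm
  have l2 : (p.dropUntil x hx).length ≠ 0 := fun h => hxb (Walk.eq_of_length_eq_zero h)
  intro e he
  rw [← Walk.take_spec p hx, Walk.edges_append, List.mem_append] at he
  rcases he with he | he
  · exact ih _ (by omega) ha hsx _ (hp.takeUntil hx) rfl e he
  · exact ih _ (by omega) hsx hb _ (hp.dropUntil hx) rfl e he

/-- Every simple path connecting two skeleton vertices uses only skeleton edges. -/
theorem stmt3 {V : Type*} (G : SimpleGraph V) (hG : IsCactus G)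
    (W : Set V) (hWfin : W.Finite) (hW : 2 ≤ W.ncard)
    {a b : V} (ha : SkeletonVertex G W a) (hb : SkeletonVertex G W b)
    (p : G.Walk a b) (hp : p.IsPath) :
    ∀ e ∈ p.edges, e ∈ Skeleton G W :=
  sk_main p.length ha hb p hp rfl
end

section
/- In the rooted tollbooth setting with distance constraints, if there exists a feasible price assignment (one realizing prescribed root-distances e_v for all v in a set S), then there exists a feasible revenue-maximizing price assignment under which the root-distance of every vertex not in S lies in {0} ∪ {b_i : i buyer} ∪ {e_v : v ∈ S}. -/
noncomputable def pdist {V : Type*} (H : SimpleGraph V) (p : Sym2 V → ℝ) (r v : V) : ℝ :=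
  sInf {c : ℝ | ∃ q : H.Walk r v, q.IsPath ∧ c = (q.edges.map p).sum}

noncomputable def revenue {V : Type*} (H : SimpleGraph V) (r : V)
    {ι : Type*} [Fintype ι] (t : ι → V) (b : ι → ℝ) (p : Sym2 V → ℝ) : ℝ :=
  ∑ i : ι, if pdist H p r (t i) ≤ b i then pdist H p r (t i) else 0

/-- A price assignment is feasible if it realizes the prescribed root-distances `e v`
for all `v ∈ S`. -/
def Feasible {V : Type*} (H : SimpleGraph V) (r : V) (S : Set V) (e : V → ℝ)
    (p : Sym2 V → ℝ) : Prop :=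
  ∀ v ∈ S, pdist H p r v = e v

theorem tb_bdd {V : Type*} (H : SimpleGraph V) (p : Sym2 V → ℝ) (hp : ∀ f, 0 ≤ p f) (r v : V) :
    BddBelow {c : ℝ | ∃ q : H.Walk r v, q.IsPath ∧ c = (q.edges.map p).sum} := by
  refine ⟨0, ?_⟩
  rintro c ⟨q, -, rfl⟩
  apply List.sum_nonneg
  intro x hx
  obtain ⟨f, -, rfl⟩ := List.mem_map.1 hx
  exact hp f

theorem tb_le_walk {V : Type*} (H : SimpleGraph V) (p : Sym2 V → ℝ) (hp : ∀ f, 0 ≤ p f)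
    (r v : V) (q : H.Walk r v) : pdist H p r v ≤ (q.edges.map p).sum := by
  classical
  refine le_trans (csInf_le (tb_bdd H p hp r v) ⟨q.bypass, q.bypass_isPath, rfl⟩) ?_
  obtain ⟨l, hl⟩ := (List.subperm_of_subset (q.bypass_isPath.isTrail.edges_nodup)
    (q.edges_bypass_subset_edges))
  have h1 : (q.bypass.edges.map p).sum = (l.map p).sum := ((hl.1.map p).sum_eq).symm
  rw [h1]
  apply List.Sublist.sum_le_sum (hl.2.map p)
  intro x hx
  obtain ⟨f, -, rfl⟩ := List.mem_map.1 hx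
  exact hp f

theorem tb_attain {V : Type*} [Fintype V] (H : SimpleGraph V) (hH : H.Connected)
    (p : Sym2 V → ℝ) (r v : V) :
    ∃ q : H.Walk r v, pdist H p r v = (q.edges.map p).sum := by
  classical
  have hne : {c : ℝ | ∃ q : H.Walk r v, q.IsPath ∧ c = (q.edges.map p).sum}.Nonempty := by
    obtain ⟨q⟩ := hH.preconnected r v
    exact ⟨_, q.bypass, q.bypass_isPath, rfl⟩
  have hfin : {c : ℝ | ∃ q : H.Walk r v, q.IsPath ∧ c = (q.edges.map p).sum}.Finite := by
    have h := (List.finite_length_le (Sym2 V) (Fintype.card V)).image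
      (fun l => (l.map p).sum)
    refine h.subset ?_
    rintro c ⟨q, hq, rfl⟩
    refine ⟨q.edges, ?_, rfl⟩
    have := hq.length_lt
    simp only [Set.mem_ofPred_eq, SimpleGraph.Walk.length_edges]
    omega
  obtain ⟨q, -, h⟩ := hne.csInf_mem hfin
  exact ⟨q, h⟩

theorem tb_step {V : Type*} [Fintype V] (H : SimpleGraph V) (hH : H.Connected)
    (p : Sym2 V → ℝ) (hp : ∀ f, 0 ≤ p f) (r u v : V) (h : H.Adj u v) :
    pdist H p r v ≤ pdist H p r u + p s(u, v) := by
  obtain ⟨q, hq⟩ := tb_attain H hH p r u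
  have := tb_le_walk H p hp r v (q.concat h)
  rw [SimpleGraph.Walk.edges_concat] at this
  simpa [hq] using this

theorem tb_nonneg {V : Type*} [Fintype V] (H : SimpleGraph V) (hH : H.Connected)
    (p : Sym2 V → ℝ) (hp : ∀ f, 0 ≤ p f) (r v : V) : 0 ≤ pdist H p r v := by
  obtain ⟨q, hq⟩ := tb_attain H hH p r v
  rw [hq]
  apply List.sum_nonneg
  intro x hx
  obtain ⟨f, -, rfl⟩ := List.mem_map.1 hx
  exact hp f

theorem tb_root {V : Type*} [Fintype V] (H : SimpleGraph V) (hH : H.Connected)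
    (p : Sym2 V → ℝ) (hp : ∀ f, 0 ≤ p f) (r : V) : pdist H p r r = 0 := by
  apply le_antisymm _ (tb_nonneg H hH p hp r r)
  simpa using tb_le_walk H p hp r r SimpleGraph.Walk.nil

theorem tb_reach_aux {V : Type*} [Fintype V] (H : SimpleGraph V) (hH : H.Connected)
    (p : Sym2 V → ℝ) (hp : ∀ f, 0 ≤ p f) (r : V) (n : ℕ) : ∀ (v : V) (q : H.Walk r v),
    q.length = n → pdist H p r v = (q.edges.map p).sum →
    Relation.ReflTransGen (fun a c => H.Adj a c ∧ pdist H p r a ≤ pdist H p r c) r v := by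
  induction n with
  | zero =>
    intro v q hq _
    obtain rfl := SimpleGraph.Walk.eq_of_length_eq_zero hq
    exact Relation.ReflTransGen.refl
  | succ n ih =>
    intro v q hq hs
    cases q with
    | nil => simp at hq
    | cons h q' =>
      obtain ⟨x, w, h', hw⟩ := SimpleGraph.Walk.exists_cons_eq_concat h q'
      rw [hw] at hs hq
      rw [SimpleGraph.Walk.length_concat] at hq
      rw [SimpleGraph.Walk.edges_concat] at hs
      simp only [List.concat_eq_append, List.map_append, List.sum_append, List.map_cons,
        List.map_nil, List.sum_cons, List.sum_nil, add_zero] at hs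
      have h1 := tb_step H hH p hp r x v h'
      have h2 := tb_le_walk H p hp r x w
      have h3 := hp s(x, v)
      refine (ih x w (by omega) (by linarith)).tail ⟨h', by linarith⟩

theorem tb_reach {V : Type*} [Fintype V] (H : SimpleGraph V) (hH : H.Connected)
    (p : Sym2 V → ℝ) (hp : ∀ f, 0 ≤ p f) (r v : V) :
    Relation.ReflTransGen (fun a c => H.Adj a c ∧ pdist H p r a ≤ pdist H p r c) r v := by
  obtain ⟨q, hq⟩ := tb_attain H hH p r v
  exact tb_reach_aux H hH p hp r _ v q rfl hq

theorem tb_realize {V : Type*} [Fintype V] (H : SimpleGraph V) (hH : H.Connected) (r : V)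
    (d : V → ℝ) (h0 : d r = 0)
    (hd : ∀ v, Relation.ReflTransGen (fun a c => H.Adj a c ∧ d a ≤ d c) r v) :
    ∃ p : Sym2 V → ℝ, (∀ f, 0 ≤ p f) ∧ ∀ v, pdist H p r v = d v := by
  let p : Sym2 V → ℝ := Sym2.lift ⟨fun a c => |d a - d c|, fun a c => abs_sub_comm _ _⟩
  have hpe : ∀ a c, p s(a, c) = |d a - d c| := fun a c => rfl
  have hp : ∀ f, 0 ≤ p f := by
    intro f
    induction f using Sym2.ind with
    | _ a c => rw [hpe]; exact abs_nonneg _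
  refine ⟨p, hp, fun v => le_antisymm ?_ ?_⟩
  · have : ∃ q : H.Walk r v, (q.edges.map p).sum = d v := by
      induction hd v with
      | refl => exact ⟨SimpleGraph.Walk.nil, by simp [h0]⟩
      | @tail x y _ hxy ih =>
        obtain ⟨q, hq⟩ := ih
        refine ⟨q.concat hxy.1, ?_⟩
        rw [SimpleGraph.Walk.edges_concat]
        simp only [List.concat_eq_append, List.map_append, List.sum_append, List.map_cons,
          List.map_nil, List.sum_cons, List.sum_nil, add_zero, hq, hpe]
        rw [abs_sub_comm, abs_of_nonneg (by linarith [hxy.2])]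
        ring
    obtain ⟨q, hq⟩ := this
    exact hq ▸ tb_le_walk H p hp r v q
  · obtain ⟨q, hq⟩ := tb_attain H hH p r v
    have key : ∀ (a c : V) (w : H.Walk a c), d c - d a ≤ (w.edges.map p).sum := by
      intro a c w
      induction w with
      | nil => simp
      | cons h w ih =>
        rename_i x y z
        simp only [SimpleGraph.Walk.edges_cons, List.map_cons, List.sum_cons, hpe]
        have := neg_abs_le (d x - d y)
        linarith
    rw [hq]
    have := key r v q
    linarith

theorem tb_round (X : Set ℝ) (hX : X.Finite) (hne : X.Nonempty) :
    ∃ φ : ℝ → ℝ, Monotone φ ∧ (∀ x, φ x ∈ X) ∧ (∀ x ∈ X, φ x = x) ∧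
      ∀ x, ∀ y ∈ X, x ≤ y → x ≤ φ x := by
  obtain ⟨M, hM, hmax⟩ := Set.exists_max_image X id hX hne
  have hn : ∀ x, {y | y ∈ X ∧ min x M ≤ y}.Nonempty := fun x => ⟨M, hM, min_le_right _ _⟩
  have hf : ∀ x, {y | y ∈ X ∧ min x M ≤ y}.Finite := fun x => hX.subset fun y hy => hy.1
  have hmem := fun x => (hn x).csInf_mem (hf x)
  refine ⟨fun x => sInf {y | y ∈ X ∧ min x M ≤ y}, ?_, fun x => (hmem x).1, ?_, ?_⟩
  · intro x y hxy
    exact csInf_le (hf x).bddBelow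
      ⟨(hmem y).1, (min_le_min_right M hxy).trans (hmem y).2⟩
  · intro x hx
    have hxM : min x M = x := min_eq_left (hmax x hx)
    apply le_antisymm
    · exact csInf_le (hf x).bddBelow ⟨hx, min_le_left _ _⟩
    · have := (hmem x).2
      exact hxM.symm.le.trans this
  · intro x y hy hxy
    have hxM : min x M = x := min_eq_left (hxy.trans (hmax y hy))
    have := (hmem x).2
    exact hxM.symm.le.trans this

/-- Rooted tollbooth with distance constraints: if a feasible nonnegative price
assignment exists, then some feasible revenue-maximizing one puts the root-distance
of every unconstrained vertex in `{0} ∪ {budgets} ∪ {prescribed distances}`. -/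
theorem stmt7 {V : Type*} [Fintype V] (H : SimpleGraph V) (hH : H.Connected) (r : V)
    {ι : Type*} [Fintype ι] (t : ι → V) (b : ι → ℝ) (hb : ∀ i, 0 < b i)
    (S : Set V) (e : V → ℝ) (he : ∀ v ∈ S, 0 ≤ e v)
    (hfeas : ∃ p : Sym2 V → ℝ, (∀ f, 0 ≤ p f) ∧ Feasible H r S e p) :
    ∃ p : Sym2 V → ℝ, (∀ f, 0 ≤ p f) ∧ Feasible H r S e p ∧
      (∀ q : Sym2 V → ℝ, (∀ f, 0 ≤ q f) → Feasible H r S e q →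
        revenue H r t b q ≤ revenue H r t b p) ∧
      (∀ v : V, v ∉ S → pdist H p r v ∈ ({0} ∪ Set.range b ∪ (e '' S) : Set ℝ)) := by
  classical
  set X : Set ℝ := {0} ∪ Set.range b ∪ (e '' S) with hXdef
  have hX : X.Finite :=
    ((Set.finite_singleton 0).union (Set.finite_range b)).union ((Set.toFinite S).image e)
  have h0X : (0 : ℝ) ∈ X := Or.inl (Or.inl rfl)
  have hbX : ∀ i, b i ∈ X := fun i => Or.inl (Or.inr ⟨i, rfl⟩)
  have heX : ∀ v ∈ S, e v ∈ X := fun v hv => Or.inr ⟨v, hv, rfl⟩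
  have hXnn : ∀ x ∈ X, 0 ≤ x := by
    rintro x ((rfl | ⟨i, rfl⟩) | ⟨v, hv, rfl⟩)
    · exact le_rfl
    · exact (hb i).le
    · exact he v hv
  obtain ⟨φ, hmono, hφX, hφid, hφle⟩ := tb_round X hX ⟨0, h0X⟩
  have round : ∀ q : Sym2 V → ℝ, (∀ f, 0 ≤ q f) → Feasible H r S e q →
      ∃ p : Sym2 V → ℝ, (∀ f, 0 ≤ p f) ∧ Feasible H r S e p ∧
        (∀ v, pdist H p r v ∈ X) ∧ revenue H r t b q ≤ revenue H r t b p := by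
    intro q hq hfq
    obtain ⟨p, hp, hpd⟩ := tb_realize H hH r (fun v => φ (pdist H q r v))
      (by rw [tb_root H hH q hq r]; exact hφid 0 h0X)
      (fun v => Relation.ReflTransGen.mono (fun a c h => ⟨h.1, hmono h.2⟩) _ _ (tb_reach H hH q hq r v))
    refine ⟨p, hp, ?_, ?_, ?_⟩
    · intro v hv
      rw [hpd, hfq v hv]
      exact hφid _ (heX v hv)
    · intro v
      rw [hpd]
      exact hφX _
    · unfold revenue
      apply Finset.sum_le_sum
      intro i _
      rw [hpd]
      by_cases h : pdist H q r (t i) ≤ b i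
      · have h' : φ (pdist H q r (t i)) ≤ b i := by
          rw [← hφid _ (hbX i)]
          exact hmono h
        rw [if_pos h, if_pos h']
        exact hφle _ _ (hbX i) h
      · rw [if_neg h]
        split_ifs
        · exact hXnn _ (hφX _)
        · exact le_rfl
  let D : Set (V → ℝ) := {d | ∃ p : Sym2 V → ℝ, (∀ f, 0 ≤ p f) ∧ Feasible H r S e p ∧
        (∀ v, pdist H p r v ∈ X) ∧ d = fun v => pdist H p r v}
  have hDfin : D.Finite := by
    refine (Set.Finite.pi' (t := fun _ : V => X) (fun _ => hX)).subset ?_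
    rintro d ⟨p, -, -, h, rfl⟩
    exact h
  have hDne : D.Nonempty := by
    obtain ⟨q, hq, hfq⟩ := hfeas
    obtain ⟨p, h1, h2, h3, -⟩ := round q hq hfq
    exact ⟨_, p, h1, h2, h3, rfl⟩
  obtain ⟨d, ⟨p, hp, hfp, hpX, rfl⟩, hmax⟩ := Set.exists_max_image D
    (fun d => ∑ i : ι, if d (t i) ≤ b i then d (t i) else 0) hDfin hDne
  refine ⟨p, hp, hfp, ?_, fun v _ => hpX v⟩
  intro q hq hfq
  obtain ⟨p', h1, h2, h3, h4⟩ := round q hq hfq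
  exact h4.trans (hmax _ ⟨p', h1, h2, h3, rfl⟩)
end
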